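/- Suppose (W,S) is a universal Coxeter system, i.e. s·t has infinite order for all distinct s, t ∈ S (equivalently, the Coxeter matrix has entry 0, denoting infinity, at every off-diagonal position). Let θ : W → W be a group automorphism mapping S onto itself, and let 𝒦 ⊆ W be a θ-twisted conjugacy class. Then the following are equivalent: (a) 𝒦 is quasiparabolic; (b) 𝒦 contains exactly one W-minimal element; (c) there exists x ∈ 𝒦 with θ(x) = x and either x = 1 or x ∈ S. -/

import Mathlib

noncomputable section

variable {B W : Type*} [Group W] {M : CoxeterMatrix B}

/-- The `θ`-twisted conjugation action of `W` on itself: `w • x = w·x·θ(w)⁻¹`. -/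
def twConj (θ : W ≃* W) (w x : W) : W := w * x * (θ w)⁻¹

/-- The height function `ht = ℓ/2` on `W`. -/
def htL (cs : CoxeterSystem M W) (x : W) : ℚ := (cs.length x : ℚ) / 2

/-- `𝒦` is a `θ`-twisted conjugacy class, i.e. an orbit of the twisted conjugation action. -/
def IsTwClass (θ : W ≃* W) (𝒦 : Set W) : Prop :=
  ∃ x₀ : W, 𝒦 = Set.range fun w => twConj θ w x₀

/-- The `θ`-twisted conjugacy class `𝒦` is quasiparabolic with respect to the height
function `ht = ℓ/2`: (QP1) and (QP2) hold. -/
def IsQPClass (cs : CoxeterSystem M W) (θ : W ≃* W) (𝒦 : Set W) : Prop :=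
  (∀ r : W, cs.IsReflection r → ∀ x ∈ 𝒦,
      htL cs (twConj θ r x) = htL cs x → twConj θ r x = x) ∧
  (∀ r : W, cs.IsReflection r → ∀ x ∈ 𝒦, ∀ i : B,
      htL cs x < htL cs (twConj θ r x) →
      htL cs (twConj θ (cs.simple i) (twConj θ r x)) < htL cs (twConj θ (cs.simple i) x) →
      twConj θ r x = twConj θ (cs.simple i) x)

/-- `x` is a `W`-minimal element: `ℓ(s·x·θ(s)⁻¹) ≥ ℓ(x)` for all simple reflections `s`. -/
def TwMin (cs : CoxeterSystem M W) (θ : W ≃* W) (x : W) : Prop :=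
  ∀ i : B, cs.length x ≤ cs.length (twConj θ (cs.simple i) x)

/-- The automorphism `θ` maps the set `S` of simple reflections onto itself. -/
def SimpleOnto (cs : CoxeterSystem M W) (θ : W ≃* W) : Prop :=
  ⇑θ '' Set.range cs.simple = Set.range cs.simple

/-- Left multiplication of a word by the letter `i`, cancelling an initial `i`. -/
def toggleHead (i : B) : List B → List B
  | [] => [i]
  | j :: l => open Classical in if i = j then l else i :: j :: l

theorem toggleHead_isChain (i : B) {l : List B} (h : l.IsChain (· ≠ ·)) :
    (toggleHead i l).IsChain (· ≠ ·) := by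
  cases l with
  | nil => simp [toggleHead]
  | cons j l =>
    by_cases hij : i = j
    · simpa [toggleHead, hij] using h.tail
    · simpa [toggleHead, hij] using h

theorem toggleHead_toggleHead (i : B) {l : List B} (h : l.IsChain (· ≠ ·)) :
    toggleHead i (toggleHead i l) = l := by
  cases l with
  | nil => simp [toggleHead]
  | cons j l =>
    by_cases hij : i = j
    · subst hij
      cases l with
      | nil => simp [toggleHead]
      | cons k l =>
        have : i ≠ k := by simp at h; exact h.1
        simp [toggleHead, this]
    · simp [toggleHead, hij]

theorem toggleHead_of_isChain {i : B} {l : List B} (h : (i :: l).IsChain (· ≠ ·)) :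
    toggleHead i l = i :: l := by
  cases l with
  | nil => rfl
  | cons j l =>
    have : i ≠ j := by simp at h; exact h.1
    simp [toggleHead, this]

theorem length_toggleHead_le (i : B) (l : List B) : (toggleHead i l).length ≤ l.length + 1 := by
  cases l with
  | nil => simp [toggleHead]
  | cons j l =>
    by_cases hij : i = j
    · simp [toggleHead, hij]
      omega
    · simp [toggleHead, hij]

theorem toggleHead_eq_cons_of_length {i : B} {l : List B}
    (h : l.length + 1 ≤ (toggleHead i l).length) : toggleHead i l = i :: l := by
  cases l with
  | nil => rfl
  | cons j l =>
    by_cases hij : i = j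
    · simp [toggleHead, hij] at h
    · simp [toggleHead, hij]

theorem wordProd_toggleHead (cs : CoxeterSystem M W) (i : B) (l : List B) :
    cs.wordProd (toggleHead i l) = cs.simple i * cs.wordProd l := by
  cases l with
  | nil => simp [toggleHead]
  | cons j l =>
    by_cases hij : i = j
    · simp [toggleHead, hij, cs.wordProd_cons]
    · simp [toggleHead, hij, cs.wordProd_cons]

/-- The action of a simple reflection of a universal Coxeter group on words without
repeated adjacent letters. -/
def toggleEnd (i : B) : Function.End {l : List B // l.IsChain (· ≠ ·)} :=
  fun l => ⟨toggleHead i l.1, toggleHead_isChain i l.2⟩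

theorem toggleEnd_isLiftable (huniv : ∀ i j : B, i ≠ j → M.M i j = 0) :
    M.IsLiftable (toggleEnd (B := B)) := by
  intro i j
  by_cases hij : i = j
  · subst hij
    rw [M.diagonal, pow_one]
    funext l
    exact Subtype.ext (toggleHead_toggleHead i l.2)
  · have : M i j = 0 := huniv i j hij
    rw [this, pow_zero]

/-- The unique reduced word of an element of a universal Coxeter group. -/
def normalWord (cs : CoxeterSystem M W) (huniv : ∀ i j : B, i ≠ j → M.M i j = 0)
    (w : W) : List B :=
  (cs.lift ⟨toggleEnd, toggleEnd_isLiftable huniv⟩ w ⟨[], .nil⟩).1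

section Universal

variable (cs : CoxeterSystem M W) (huniv : ∀ i j : B, i ≠ j → M.M i j = 0)

theorem normalWord_isChain (w : W) : (normalWord cs huniv w).IsChain (· ≠ ·) :=
  Subtype.property _

theorem normalWord_one : normalWord cs huniv 1 = [] := by
  rw [normalWord, map_one]
  rfl

theorem normalWord_simple_mul (i : B) (w : W) :
    normalWord cs huniv (cs.simple i * w) = toggleHead i (normalWord cs huniv w) := by
  simp only [normalWord, map_mul, cs.lift_apply_simple]
  rfl

theorem wordProd_normalWord (w : W) : cs.wordProd (normalWord cs huniv w) = w := by
  induction w using cs.simple_induction_left with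
  | one => simp [normalWord_one]
  | mul_simple_left w i ih => rw [normalWord_simple_mul, wordProd_toggleHead, ih]

theorem normalWord_wordProd {l : List B} (h : l.IsChain (· ≠ ·)) :
    normalWord cs huniv (cs.wordProd l) = l := by
  induction l with
  | nil => simp [normalWord_one]
  | cons i l ih =>
    rw [cs.wordProd_cons, normalWord_simple_mul, ih h.tail, toggleHead_of_isChain h]

theorem wordProd_injOn_isChain (huniv : ∀ i j : B, i ≠ j → M.M i j = 0) {l l' : List B}
    (h : l.IsChain (· ≠ ·))
    (h' : l'.IsChain (· ≠ ·)) (e : cs.wordProd l = cs.wordProd l') : l = l' := by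
  rw [← normalWord_wordProd cs huniv h, e, normalWord_wordProd cs huniv h']

theorem length_normalWord_wordProd_le (l : List B) :
    (normalWord cs huniv (cs.wordProd l)).length ≤ l.length := by
  induction l with
  | nil => simp [normalWord_one]
  | cons i l ih =>
    rw [cs.wordProd_cons, normalWord_simple_mul]
    have := length_toggleHead_le i (normalWord cs huniv (cs.wordProd l))
    simp only [List.length_cons]
    omega

theorem length_normalWord (w : W) : (normalWord cs huniv w).length = cs.length w := by
  apply le_antisymm
  · obtain ⟨l, hl, rfl⟩ := cs.exists_isReduced w
    rw [hl.eq]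
    exact length_normalWord_wordProd_le cs huniv l
  · conv_lhs => rw [← wordProd_normalWord cs huniv w]
    exact cs.length_wordProd_le _

theorem length_wordProd_of_isChain (huniv : ∀ i j : B, i ≠ j → M.M i j = 0) {l : List B}
    (h : l.IsChain (· ≠ ·)) : cs.length (cs.wordProd l) = l.length := by
  rw [← length_normalWord cs huniv, normalWord_wordProd cs huniv h]

theorem normalWord_wordProd_of_length {l : List B} (h : l.length ≤ cs.length (cs.wordProd l)) :
    normalWord cs huniv (cs.wordProd l) = l := by
  induction l with
  | nil => simp [normalWord_one]
  | cons i l ih =>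
    rw [← length_normalWord cs huniv, cs.wordProd_cons, normalWord_simple_mul] at h
    rw [cs.wordProd_cons, normalWord_simple_mul]
    have h1 := length_toggleHead_le i (normalWord cs huniv (cs.wordProd l))
    have h2 := length_normalWord_wordProd_le cs huniv l
    simp only [List.length_cons] at h
    have h3 := ih (by rw [← length_normalWord cs huniv]; omega)
    rw [h3] at h ⊢
    exact toggleHead_eq_cons_of_length h

end Universal


theorem twConj_mul (θ : W ≃* W) (v w x : W) :
    twConj θ (v * w) x = twConj θ v (twConj θ w x) := by
  simp [twConj, mul_assoc]

theorem twConj_one (θ : W ≃* W) (x : W) : twConj θ 1 x = x := by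
  simp [twConj]

theorem IsTwClass.twConj_mem {θ : W ≃* W} {𝒦 : Set W} (hK : IsTwClass θ 𝒦) {x : W}
    (hx : x ∈ 𝒦) (w : W) : twConj θ w x ∈ 𝒦 := by
  obtain ⟨x₀, rfl⟩ := hK
  obtain ⟨v, rfl⟩ := hx
  exact ⟨w * v, twConj_mul θ w v x₀⟩

theorem IsTwClass.exists_twConj {θ : W ≃* W} {𝒦 : Set W} (hK : IsTwClass θ 𝒦) {x y : W}
    (hx : x ∈ 𝒦) (hy : y ∈ 𝒦) : ∃ w, y = twConj θ w x := by
  obtain ⟨x₀, rfl⟩ := hK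
  obtain ⟨v, rfl⟩ := hx
  obtain ⟨w, rfl⟩ := hy
  refine ⟨w * v⁻¹, ?_⟩
  simp only
  rw [← twConj_mul, inv_mul_cancel_right]

theorem htL_lt_iff (cs : CoxeterSystem M W) (x y : W) :
    htL cs x < htL cs y ↔ cs.length x < cs.length y := by
  unfold htL
  rw [div_lt_div_iff_of_pos_right (by norm_num)]
  exact Nat.cast_lt

theorem htL_eq_iff (cs : CoxeterSystem M W) (x y : W) :
    htL cs x = htL cs y ↔ cs.length x = cs.length y := by
  unfold htL
  rw [div_left_inj' (by norm_num)]
  exact Nat.cast_inj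

theorem List.isChain_ne_reverse {l : List B} (h : l.IsChain (· ≠ ·)) :
    l.reverse.IsChain (· ≠ ·) := by
  rw [List.isChain_reverse]
  exact h.imp fun _ _ => Ne.symm

theorem List.exists_common_suffix {X Y : List B} (h : X.length = Y.length) :
    X = Y ∨ ∃ X' Y' t a b, a ≠ b ∧ X = X' ++ [a] ++ t ∧ Y = Y' ++ [b] ++ t := by
  induction X using List.reverseRecOn generalizing Y with
  | nil => exact .inl (List.eq_nil_of_length_eq_zero (by simpa using h.symm)).symm
  | append_singleton X a ih =>
    rcases List.eq_nil_or_concat Y with rfl | ⟨Y, b, rfl⟩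
    · simp at h
    by_cases hab : a = b
    · subst hab
      rcases ih (Y := Y) (by simpa using h) with rfl | ⟨X', Y', t, c, d, hcd, rfl, rfl⟩
      · left; simp
      · exact .inr ⟨X', Y', t ++ [a], c, d, hcd, by simp, by simp⟩
    · exact .inr ⟨X, Y, [], a, b, hab, by simp, by simp⟩

/-- An involution given by a product of words `P` and `Q⁻¹` whose concatenation has no repeated
adjacent letters has the same reduced word when `P` and `Q` are exchanged. -/
theorem append_reverse_comm_of_isChain (cs : CoxeterSystem M W)
    (huniv : ∀ i j : B, i ≠ j → M.M i j = 0) {r : W} (hr : r⁻¹ = r) {l : List B}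
    (h : l.IsChain (· ≠ ·)) (e : r = cs.wordProd l) : l = l.reverse := by
  refine wordProd_injOn_isChain cs huniv h (List.isChain_ne_reverse h) ?_
  rw [cs.wordProd_reverse, ← e, hr]

/-- The combinatorial data of a universal Coxeter system with a diagram map `σ` and a `θ`-fixed
element with reduced word `base`, whose stabilizer is generated by the letters in `J`. -/
structure FixedBase (cs : CoxeterSystem M W) (θ : W ≃* W) (σ : B → B) (base : List B)
    (J : B → Prop) : Prop where
  univ : ∀ i j : B, i ≠ j → M.M i j = 0
  map_simple : ∀ i, θ (cs.simple i) = cs.simple (σ i)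
  inj : Function.Injective σ
  chain : base.IsChain (· ≠ ·)
  stab : ∀ i, J i → twConj θ (cs.simple i) (cs.wordProd base) = cs.wordProd base
  chain_conj : ∀ i, ¬ J i → ([i] ++ base ++ [σ i]).IsChain (· ≠ ·)

/-- Words without repeated adjacent letters that do not end in a letter from `J`. -/
def IsCosetWord (J : B → Prop) (X : List B) : Prop :=
  X.IsChain (· ≠ ·) ∧ ∀ i ∈ X.getLast?, ¬ J i

theorem IsCosetWord.of_cons {J : B → Prop} {i : B} {X : List B} (h : IsCosetWord J (i :: X)) :
    IsCosetWord J X := by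
  refine ⟨h.1.tail, fun j hj => h.2 j ?_⟩
  cases X with
  | nil => simp at hj
  | cons k X => simpa [List.getLast?_cons_cons] using hj

theorem exists_isCosetWord_append (J : B → Prop) {l : List B} (h : l.IsChain (· ≠ ·)) :
    ∃ X u, l = X ++ u ∧ IsCosetWord J X ∧ ∀ i ∈ u, J i := by
  induction l using List.reverseRecOn with
  | nil => exact ⟨[], [], rfl, ⟨.nil, by simp⟩, by simp⟩
  | append_singleton l a ih =>
    by_cases ha : J a
    · obtain ⟨X, u, rfl, hX, hu⟩ := ih (List.isChain_append.1 h).1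
      refine ⟨X, u ++ [a], by simp, hX, fun i hi => ?_⟩
      rcases List.mem_append.1 hi with hi | hi
      · exact hu i hi
      · rwa [List.mem_singleton.1 hi]
    · refine ⟨l ++ [a], [], by simp, ⟨h, fun i hi => ?_⟩, by simp⟩
      have : a = i := by simpa using hi
      rwa [← this]

theorem IsCosetWord.isChain_append {J : B → Prop} {X Y u : List B} (hX : IsCosetWord J X)
    (hY : IsCosetWord J Y) (hu : u.IsChain (· ≠ ·)) (hJ : ∀ i ∈ u, J i) (hne : u ≠ []) :
    (Y ++ u ++ X.reverse).IsChain (· ≠ ·) := by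
  have h1 : (Y ++ u).IsChain (· ≠ ·) := by
    refine List.isChain_append.2 ⟨hY.1, hu, fun i hi j hj hij => hY.2 i hi ?_⟩
    rw [hij]
    exact hJ j (List.mem_of_mem_head? hj)
  have h2 : (u ++ X.reverse).IsChain (· ≠ ·) := by
    refine List.isChain_append.2 ⟨hu, List.isChain_ne_reverse hX.1, fun i hi j hj hij => ?_⟩
    refine hX.2 j (by simpa using hj) ?_
    rw [← hij]
    exact hJ i (List.mem_of_mem_getLast? hi)
  exact h1.append_overlap h2 hne

namespace FixedBase

variable {cs : CoxeterSystem M W} {θ : W ≃* W} {σ : B → B} {base : List B} {J : B → Prop}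

theorem map_wordProd (H : FixedBase cs θ σ base J) (l : List B) :
    θ (cs.wordProd l) = cs.wordProd (l.map σ) := by
  induction l with
  | nil => simp
  | cons i l ih => simp [cs.wordProd_cons, H.map_simple, ih]

theorem twConj_wordProd (H : FixedBase cs θ σ base J) (X : List B) :
    twConj θ (cs.wordProd X) (cs.wordProd base) =
      cs.wordProd (X ++ base ++ (X.map σ).reverse) := by
  simp only [twConj, H.map_wordProd, cs.wordProd_append, cs.wordProd_reverse]

theorem isChain_conj (H : FixedBase cs θ σ base J) {X : List B} (hX : IsCosetWord J X) :
    (X ++ base ++ (X.map σ).reverse).IsChain (· ≠ ·) := by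
  rcases List.eq_nil_or_concat X with rfl | ⟨X, a, rfl⟩
  · simpa using H.chain
  have ha : ¬ J a := hX.2 a (by simp)
  have hc : (X ++ [a]).IsChain (· ≠ ·) := by simpa using hX.1
  have h1 : (X ++ [a] ++ (base ++ [σ a])).IsChain (· ≠ ·) :=
    hc.append_overlap (by simpa using H.chain_conj a ha) (by simp)
  have h2 : ((X ++ [a]).map σ).reverse.IsChain (· ≠ ·) := by
    refine List.isChain_ne_reverse ?_
    rw [List.isChain_map]
    exact hc.imp fun _ _ h e => h (H.inj e)
  have h3 : ([σ a] ++ (X.map σ).reverse).IsChain (· ≠ ·) := by simpa using h2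
  have h4 := List.IsChain.append_overlap (l₁ := X ++ [a] ++ base) (by simpa using h1) h3 (by simp)
  simpa using h4

theorem length_twConj (H : FixedBase cs θ σ base J) {X : List B} (hX : IsCosetWord J X) :
    cs.length (twConj θ (cs.wordProd X) (cs.wordProd base)) = 2 * X.length + base.length := by
  rw [H.twConj_wordProd, length_wordProd_of_isChain cs H.univ (H.isChain_conj hX)]
  simp
  omega

theorem twConj_of_forall_mem (H : FixedBase cs θ σ base J) {u : List B} (hu : ∀ i ∈ u, J i) :
    twConj θ (cs.wordProd u) (cs.wordProd base) = cs.wordProd base := by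
  induction u with
  | nil => simp [twConj_one]
  | cons i u ih =>
    rw [cs.wordProd_cons, twConj_mul, ih fun j hj => hu j (by simp [hj]), H.stab i (hu i (by simp))]

theorem exists_isCosetWord (H : FixedBase cs θ σ base J) (w : W) :
    ∃ X, IsCosetWord J X ∧ twConj θ w (cs.wordProd base) =
      twConj θ (cs.wordProd X) (cs.wordProd base) := by
  obtain ⟨X, u, h, hX, hu⟩ := exists_isCosetWord_append J (normalWord_isChain cs H.univ w)
  refine ⟨X, hX, ?_⟩
  rw [← wordProd_normalWord cs H.univ w, h, cs.wordProd_append, twConj_mul,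
    H.twConj_of_forall_mem hu]

theorem exists_isCosetWord_of_mem (H : FixedBase cs θ σ base J) {𝒦 : Set W}
    (hK : IsTwClass θ 𝒦) (hb : cs.wordProd base ∈ 𝒦) {x : W} (hx : x ∈ 𝒦) :
    ∃ X, IsCosetWord J X ∧ x = twConj θ (cs.wordProd X) (cs.wordProd base) := by
  obtain ⟨w, rfl⟩ := hK.exists_twConj hb hx
  exact H.exists_isCosetWord w

theorem forall_mem_of_twConj_eq (H : FixedBase cs θ σ base J) {l : List B}
    (hl : l.IsChain (· ≠ ·))
    (h : twConj θ (cs.wordProd l) (cs.wordProd base) = cs.wordProd base) : ∀ i ∈ l, J i := by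
  obtain ⟨X, u, rfl, hX, hu⟩ := exists_isCosetWord_append J hl
  rw [cs.wordProd_append, twConj_mul, H.twConj_of_forall_mem hu] at h
  have h1 := H.length_twConj hX
  rw [h, length_wordProd_of_isChain cs H.univ H.chain] at h1
  have : X = [] := List.eq_nil_of_length_eq_zero (by omega)
  simpa [this] using hu

theorem exists_middle (H : FixedBase cs θ σ base J) (r : W) {X Y : List B}
    (h : twConj θ r (twConj θ (cs.wordProd X) (cs.wordProd base)) =
      twConj θ (cs.wordProd Y) (cs.wordProd base)) :
    ∃ u : List B, u.IsChain (· ≠ ·) ∧ (∀ i ∈ u, J i) ∧ r = cs.wordProd (Y ++ u ++ X.reverse) := by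
  have e : r = cs.wordProd Y * ((cs.wordProd Y)⁻¹ * r * cs.wordProd X) * (cs.wordProd X)⁻¹ := by
    group
  refine ⟨normalWord cs H.univ ((cs.wordProd Y)⁻¹ * r * cs.wordProd X),
    normalWord_isChain cs H.univ _, ?_, ?_⟩
  · refine H.forall_mem_of_twConj_eq (normalWord_isChain cs H.univ _) ?_
    rw [wordProd_normalWord, mul_assoc, twConj_mul, twConj_mul, h, ← twConj_mul,
      inv_mul_cancel, twConj_one]
  · rwa [cs.wordProd_append, cs.wordProd_append, wordProd_normalWord, cs.wordProd_reverse]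

theorem eq_of_reflection_of_length_eq (H : FixedBase cs θ σ base J) {r : W}
    (hr : cs.IsReflection r) {X Y : List B} (hX : IsCosetWord J X) (hY : IsCosetWord J Y)
    (h : twConj θ r (twConj θ (cs.wordProd X) (cs.wordProd base)) =
      twConj θ (cs.wordProd Y) (cs.wordProd base)) (hlen : X.length = Y.length) : Y = X := by
  obtain ⟨u, hu, hJ, e⟩ := H.exists_middle r h
  by_cases hne : u = []
  · subst hne
    have h1 := hr.odd_length
    have h2 := cs.length_mul_mod_two (cs.wordProd Y) (cs.wordProd X.reverse)
    rw [List.append_nil, cs.wordProd_append] at e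
    rw [← e, cs.wordProd_reverse, cs.length_inv, length_wordProd_of_isChain cs H.univ hX.1,
      length_wordProd_of_isChain cs H.univ hY.1] at h2
    rw [Nat.odd_iff] at h1
    omega
  · have h1 := append_reverse_comm_of_isChain cs H.univ hr.inv
      (hX.isChain_append hY hu hJ hne) e
    simp only [List.reverse_append, List.reverse_reverse, List.append_assoc] at h1
    exact (List.append_inj h1 hlen.symm).1

theorem eq_of_reflection_of_cons (H : FixedBase cs θ σ base J) {r : W}
    (hr : cs.IsReflection r) {i : B} {X Y : List B} (hX : IsCosetWord J (i :: X))
    (hY : IsCosetWord J (i :: Y))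
    (h : twConj θ r (twConj θ (cs.wordProd X) (cs.wordProd base)) =
      twConj θ (cs.wordProd (i :: Y)) (cs.wordProd base)) (hlen : X.length = Y.length) :
    Y = X := by
  obtain ⟨u, hu, hJ, e⟩ := H.exists_middle r h
  by_cases hne : u = []
  · subst hne
    rcases List.exists_common_suffix hlen with rfl | ⟨X', Y', t, a, b, hab, rfl, rfl⟩
    · rfl
    exfalso
    have hY1 : (i :: Y' ++ [b]).IsChain (· ≠ ·) :=
      (List.isChain_append (l₂ := t).1 (by simpa using hY.1)).1
    have hX1 : (i :: X' ++ [a]).IsChain (· ≠ ·) :=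
      (List.isChain_append (l₂ := t).1 (by simpa using hX.1)).1
    have hX2 : (X' ++ [a]).reverse.IsChain (· ≠ ·) := List.isChain_ne_reverse hX1.tail
    have e' : r = cs.wordProd ((i :: Y' ++ [b]) ++ (X' ++ [a]).reverse) := by
      rw [e]
      simp [cs.wordProd_append, cs.wordProd_cons]
    have hc : ((i :: Y' ++ [b]) ++ (X' ++ [a]).reverse).IsChain (· ≠ ·) := by
      refine List.isChain_append.2 ⟨hY1, hX2, fun c hc d hd => ?_⟩
      have h1 : b = c := by
        rw [List.getLast?_concat] at hc
        simpa using hc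
      have h2 : a = d := by simpa using hd
      rw [← h1, ← h2]
      exact hab.symm
    have h1 := append_reverse_comm_of_isChain cs H.univ hr.inv hc e'
    cases X' <;> simp at h1 hX1
    · exact hX1 h1.1
    · exact hX1.1 h1.1
  · have h1 := append_reverse_comm_of_isChain cs H.univ hr.inv
      (hX.of_cons.isChain_append hY hu hJ hne) e
    cases X with
    | nil => exact List.eq_nil_of_length_eq_zero hlen.symm
    | cons a X =>
      exfalso
      have h2 := hX.1
      simp at h1 h2
      exact h2.1 h1.1

theorem twConj_simple_cons (_ : FixedBase cs θ σ base J) (i : B) (X : List B) :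
    twConj θ (cs.simple i) (twConj θ (cs.wordProd (i :: X)) (cs.wordProd base)) =
      twConj θ (cs.wordProd X) (cs.wordProd base) := by
  rw [← twConj_mul, cs.wordProd_cons, cs.simple_mul_simple_cancel_left]

theorem length_twConj_simple_of_isCosetWord_cons (H : FixedBase cs θ σ base J) {i : B}
    {X : List B} (hX : IsCosetWord J (i :: X)) :
    cs.length (twConj θ (cs.simple i) (twConj θ (cs.wordProd X) (cs.wordProd base))) =
      2 * X.length + 2 + base.length := by
  rw [← twConj_mul, ← cs.wordProd_cons, H.length_twConj hX]
  simp
  omega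

theorem length_twConj_simple_le (H : FixedBase cs θ σ base J) {i : B} {X : List B}
    (hX : IsCosetWord J X) (hi : ¬ IsCosetWord J (i :: X)) :
    cs.length (twConj θ (cs.simple i) (twConj θ (cs.wordProd X) (cs.wordProd base))) ≤
      2 * X.length + base.length := by
  cases X with
  | nil =>
    have hJ : J i := by
      by_contra hJ
      exact hi ⟨by simp, by simpa using hJ⟩
    rw [cs.wordProd_nil, twConj_one, H.stab i hJ]
    exact (cs.length_wordProd_le base).trans (by simp)
  | cons j X =>
    have hij : i = j := by
      by_contra hij
      exact hi ⟨by simpa [hij] using hX.1, by simpa [List.getLast?_cons_cons] using hX.2⟩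
    subst hij
    rw [H.twConj_simple_cons, H.length_twConj hX.of_cons]
    simp

theorem isQPClass (H : FixedBase cs θ σ base J) {𝒦 : Set W} (hK : IsTwClass θ 𝒦)
    (hb : cs.wordProd base ∈ 𝒦) : IsQPClass cs θ 𝒦 := by
  refine ⟨fun r hr x hx h => ?_, fun r hr x hx i h1 h2 => ?_⟩
  all_goals
    obtain ⟨X, hX, rfl⟩ := H.exists_isCosetWord_of_mem hK hb hx
    obtain ⟨Y, hY, hYw⟩ := H.exists_isCosetWord_of_mem hK hb (hK.twConj_mem hx r)
  · rw [htL_eq_iff, hYw, H.length_twConj hX, H.length_twConj hY] at h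
    rw [hYw, H.eq_of_reflection_of_length_eq hr hX hY hYw (by omega)]
  · rw [htL_lt_iff, hYw, H.length_twConj hX, H.length_twConj hY] at h1
    rw [htL_lt_iff, hYw] at h2
    have hX1 : cs.length (twConj θ (cs.simple i)
        (twConj θ (cs.wordProd X) (cs.wordProd base))) ≤ 2 * X.length + 2 + base.length := by
      by_cases hi : IsCosetWord J (i :: X)
      · exact (H.length_twConj_simple_of_isCosetWord_cons hi).le
      · exact (H.length_twConj_simple_le hX hi).trans (by omega)
    have hiY : ¬ IsCosetWord J (i :: Y) := fun hi => by
      rw [H.length_twConj_simple_of_isCosetWord_cons hi] at h2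
      omega
    cases Y with
    | nil => simp at h1
    | cons j Y =>
      have hij : i = j := by
        by_contra hij
        exact hiY ⟨by simpa [hij] using hY.1, by simpa [List.getLast?_cons_cons] using hY.2⟩
      subst hij
      rw [H.twConj_simple_cons, H.length_twConj hY.of_cons] at h2
      rw [List.length_cons] at h1
      have hiX : IsCosetWord J (i :: X) := by
        by_contra hi
        have := H.length_twConj_simple_le hX hi
        omega
      rw [H.length_twConj_simple_of_isCosetWord_cons hiX] at h2
      rw [hYw, H.eq_of_reflection_of_cons hr hiX hY hYw (by omega), cs.wordProd_cons, twConj_mul]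

theorem existsUnique_twMin (H : FixedBase cs θ σ base J) {𝒦 : Set W} (hK : IsTwClass θ 𝒦)
    (hb : cs.wordProd base ∈ 𝒦) : ∃! x : W, x ∈ 𝒦 ∧ TwMin cs θ x := by
  refine ⟨cs.wordProd base, ⟨hb, fun i => ?_⟩, fun x hx => ?_⟩
  · obtain ⟨X, hX, hXw⟩ := H.exists_isCosetWord (cs.simple i)
    rw [hXw, H.length_twConj hX]
    exact (cs.length_wordProd_le base).trans (by omega)
  · obtain ⟨hx, hmin⟩ := hx
    obtain ⟨X, hX, rfl⟩ := H.exists_isCosetWord_of_mem hK hb hx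
    cases X with
    | nil => rw [cs.wordProd_nil, twConj_one]
    | cons i X =>
      have := hmin i
      rw [H.twConj_simple_cons, H.length_twConj hX, H.length_twConj hX.of_cons] at this
      simp at this

end FixedBase

theorem simple_injective_of_universal (cs : CoxeterSystem M W)
    (huniv : ∀ i j : B, i ≠ j → M.M i j = 0) : Function.Injective cs.simple := by
  intro i j h
  have := wordProd_injOn_isChain cs huniv (l := [i]) (l' := [j]) (by simp) (by simp) (by simpa)
  simpa using this

theorem exists_fixedBase (cs : CoxeterSystem M W) (huniv : ∀ i j : B, i ≠ j → M.M i j = 0)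
    {θ : W ≃* W} {σ : B → B} (hσ : ∀ i, θ (cs.simple i) = cs.simple (σ i)) {x : W}
    (hx : θ x = x) (hx' : x = 1 ∨ x ∈ Set.range cs.simple) :
    ∃ base J, FixedBase cs θ σ base J ∧ cs.wordProd base = x := by
  have hs := simple_injective_of_universal cs huniv
  have hinj : Function.Injective σ := fun i j h =>
    hs (θ.injective (by rw [hσ, hσ, h]))
  rcases hx' with rfl | ⟨k, rfl⟩
  · refine ⟨[], fun i => σ i = i, ⟨huniv, hσ, hinj, .nil, fun i hi => ?_, fun i hi => ?_⟩, by simp⟩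
    · simp [twConj, hσ, hi]
    · simpa using Ne.symm hi
  · have hk : σ k = k := hs (by rw [← hσ, hx])
    refine ⟨[k], fun i => i = k, ⟨huniv, hσ, hinj, by simp, fun i hi => ?_, fun i hi => ?_⟩,
      by simp⟩
    · simp [twConj, hσ, hi, hk]
    · have : k ≠ σ i := fun h => hi (hinj (by rw [← h, hk]))
      simpa using ⟨hi, this⟩

/-- A class without a suitable `θ`-fixed element contains an element of minimal length that a
simple reflection moves to a different element of the same length. -/
theorem exists_fixed_or_moved (cs : CoxeterSystem M W)
    (huniv : ∀ i j : B, i ≠ j → M.M i j = 0) {θ : W ≃* W} {σ : B → B}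
    (hσ : ∀ i, θ (cs.simple i) = cs.simple (σ i)) {𝒦 : Set W} (hK : IsTwClass θ 𝒦) :
    (∃ x ∈ 𝒦, θ x = x ∧ (x = 1 ∨ x ∈ Set.range cs.simple)) ∨
    ∃ x ∈ 𝒦, (∀ y ∈ 𝒦, cs.length x ≤ cs.length y) ∧ ∃ i,
      cs.length (twConj θ (cs.simple i) x) = cs.length x ∧ twConj θ (cs.simple i) x ≠ x := by
  have hne : 𝒦.Nonempty := by
    obtain ⟨x₀, rfl⟩ := hK
    exact Set.range_nonempty _
  obtain ⟨x, hx, hmin⟩ : ∃ x ∈ 𝒦, ∀ y ∈ 𝒦, cs.length x ≤ cs.length y :=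
    ⟨_, Function.argminOn_mem cs.length 𝒦 hne, fun y hy => Function.argminOn_le cs.length 𝒦 hy⟩
  obtain ⟨l, hl, rfl⟩ : ∃ l : List B, l.IsChain (· ≠ ·) ∧ cs.wordProd l = x :=
    ⟨_, normalWord_isChain cs huniv x, wordProd_normalWord cs huniv x⟩
  cases l with
  | nil => exact .inl ⟨_, hx, by simp, by simp⟩
  | cons a t =>
    have hy : twConj θ (cs.simple a) (cs.wordProd (a :: t)) = cs.wordProd (t ++ [σ a]) := by
      simp [twConj, hσ, cs.wordProd_cons, cs.wordProd_append]
    have hlen : cs.length (cs.wordProd (a :: t)) = t.length + 1 :=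
      length_wordProd_of_isChain cs huniv hl
    have hle := hmin _ (hK.twConj_mem hx (cs.simple a))
    have hge := cs.length_wordProd_le (t ++ [σ a])
    rw [List.length_append, List.length_singleton] at hge
    by_cases heq : twConj θ (cs.simple a) (cs.wordProd (a :: t)) = cs.wordProd (a :: t)
    · left
      have h1 := normalWord_wordProd_of_length cs huniv (l := t ++ [σ a])
        (by rw [← hy, List.length_append, List.length_singleton]; omega)
      rw [← hy, heq, normalWord_wordProd cs huniv hl] at h1
      cases t with
      | nil =>
        have ha : a = σ a := by simpa using h1
        exact ⟨_, hx, by simp [hσ, ← ha], .inr ⟨a, by simp⟩⟩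
      | cons b t =>
        simp at h1 hl
        exact absurd h1.1 hl.1
    · exact .inr ⟨_, hx, hmin, a, by rw [hy] at hle ⊢; omega, heq⟩

/-- Suppose `(W,S)` is universal (all off-diagonal Coxeter matrix entries
are `0`, denoting infinity). For a `θ`-twisted conjugacy class `𝒦`, the following are
equivalent: (a) `𝒦` is quasiparabolic; (b) `𝒦` contains exactly one `W`-minimal element;
(c) `𝒦` contains an element `x` with `θ(x) = x` and `x = 1` or `x ∈ S`. -/
theorem stmt17 (cs : CoxeterSystem M W) (huniv : ∀ i j : B, i ≠ j → M.M i j = 0)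
    (θ : W ≃* W) (hθS : SimpleOnto cs θ) (𝒦 : Set W) (hK : IsTwClass θ 𝒦) :
    (IsQPClass cs θ 𝒦 ↔ (∃! x : W, x ∈ 𝒦 ∧ TwMin cs θ x)) ∧
    (IsQPClass cs θ 𝒦 ↔
      (∃ x ∈ 𝒦, θ x = x ∧ (x = 1 ∨ x ∈ Set.range cs.simple))) := by
  have hσ' : ∀ i, ∃ j, θ (cs.simple i) = cs.simple j := fun i => by
    have h : θ (cs.simple i) ∈ Set.range cs.simple := hθS ▸ ⟨_, ⟨i, rfl⟩, rfl⟩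
    obtain ⟨j, hj⟩ := h
    exact ⟨j, hj.symm⟩
  choose σ hσ using hσ'
  have hc : (∃ x ∈ 𝒦, θ x = x ∧ (x = 1 ∨ x ∈ Set.range cs.simple)) →
      IsQPClass cs θ 𝒦 ∧ ∃! x : W, x ∈ 𝒦 ∧ TwMin cs θ x := by
    rintro ⟨x, hx, hfix, hx'⟩
    obtain ⟨base, J, H, rfl⟩ := exists_fixedBase cs huniv hσ hfix hx'
    exact ⟨H.isQPClass hK hx, H.existsUnique_twMin hK hx⟩
  have hac : IsQPClass cs θ 𝒦 → ∃ x ∈ 𝒦, θ x = x ∧ (x = 1 ∨ x ∈ Set.range cs.simple) := by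
    intro hqp
    rcases exists_fixed_or_moved cs huniv hσ hK with h | ⟨x, hx, -, i, hlen, hmove⟩
    · exact h
    · exact absurd (hqp.1 _ (cs.isReflection_simple i) x hx ((htL_eq_iff cs _ _).2 hlen)) hmove
  have hbc : (∃! x : W, x ∈ 𝒦 ∧ TwMin cs θ x) →
      ∃ x ∈ 𝒦, θ x = x ∧ (x = 1 ∨ x ∈ Set.range cs.simple) := by
    intro huniq
    rcases exists_fixed_or_moved cs huniv hσ hK with h | ⟨x, hx, hmin, i, hlen, hmove⟩
    · exact h
    · have hy := hK.twConj_mem hx (cs.simple i)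
      refine absurd (huniq.unique ⟨hy, fun j => ?_⟩ ⟨hx, fun j => ?_⟩) hmove
      · rw [hlen]
        exact hmin _ (hK.twConj_mem hy _)
      · exact hmin _ (hK.twConj_mem hx _)
  exact ⟨⟨fun h => (hc (hac h)).2, fun h => (hc (hbc h)).1⟩, hac, fun h => (hc h).1⟩

end
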